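/- In the simple-interest model: for any x > 0, if θ(M) = T (i.e. even the maximal strategy t ↦ M(t) never repays any principal by time T), then the strategy α*(t) := m(t) for all t ∈ [0,T] attains the infimum defining v(x), i.e. J(x, α*) = v(x). -/

import Mathlib

open MeasureTheory Set

noncomputable section

/-- Admissible repayment strategies: measurable, with `m t ≤ α t ≤ M t` on `[0,T]`. -/
def Adm (T : ℝ) (m M : ℝ → ℝ) : Set (ℝ → ℝ) :=
  {α | Measurable α ∧ ∀ t ∈ Icc (0:ℝ) T, m t ≤ α t ∧ α t ≤ M t}

/-- Compound-interest balance. -/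
def balC (r β x : ℝ) (α : ℝ → ℝ) (t : ℝ) : ℝ :=
  Real.exp ((r + β) * t) * (x - ∫ s in (0:ℝ)..t, Real.exp (-(r + β) * s) * α s)

/-- Terminal time: first zero of the balance in `[0,T]`, capped at `T`. -/
def tauC (r β T x : ℝ) (α : ℝ → ℝ) : ℝ :=
  sInf (insert T {t | t ∈ Icc (0:ℝ) T ∧ balC r β x α t = 0})

/-- Repayment cost. -/
def costC (r β T ω x : ℝ) (α : ℝ → ℝ) : ℝ :=
  (∫ t in (0:ℝ)..(tauC r β T x α), Real.exp (-r * t) * α t)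
    + ω * Real.exp (-r * tauC r β T x α) * balC r β x α (tauC r β T x α)

/-- Value function. -/
def valC (r β T ω : ℝ) (m M : ℝ → ℝ) (x : ℝ) : ℝ :=
  sInf (costC r β T ω x '' Adm T m M)

/-- Critical horizon `t_c = max(T + log ω / β, 0)`. -/
def tCrit (β T ω : ℝ) : ℝ := max (T + Real.log ω / β) 0

/-- The cost `v₁` of the max-min strategy. -/
def vOne (r β T ω : ℝ) (m M : ℝ → ℝ) (x : ℝ) : ℝ :=
  (∫ s in (0:ℝ)..(tCrit β T ω), Real.exp (-r * s) * M s)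
  + (∫ s in (tCrit β T ω)..T, Real.exp (-r * s) * m s)
  + ω * Real.exp (β * T) *
    (x - (∫ s in (0:ℝ)..(tCrit β T ω), Real.exp (-(r + β) * s) * M s)
       - ∫ s in (tCrit β T ω)..T, Real.exp (-(r + β) * s) * m s)

/-- `x̂ = ∫_0^{t_c} e^{-(r+β)s} M(s) ds`. -/
def xHat (r β T ω : ℝ) (M : ℝ → ℝ) : ℝ :=
  ∫ s in (0:ℝ)..(tCrit β T ω), Real.exp (-(r + β) * s) * M s

/-- `x̄ = ∫_0^T e^{-(r+β)s} M(s) ds`. -/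
def xBar (r β T : ℝ) (M : ℝ → ℝ) : ℝ :=
  ∫ s in (0:ℝ)..T, Real.exp (-(r + β) * s) * M s

/-- `x̲ = ∫_0^T e^{-(r+β)s} m(s) ds`. -/
def xLow (r β T : ℝ) (m : ℝ → ℝ) : ℝ :=
  ∫ s in (0:ℝ)..T, Real.exp (-(r + β) * s) * m s

/-- `x_c = ∫_0^{t_c} e^{-(r+β)s} M(s) ds + ∫_{t_c}^T e^{-(r+β)s} m(s) ds`. -/
def xCrit (r β T ω : ℝ) (m M : ℝ → ℝ) : ℝ :=
  xHat r β T ω M + ∫ s in (tCrit β T ω)..T, Real.exp (-(r + β) * s) * m s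
/-- Running infimum of the balance: the principal. -/
def runInf (b : ℝ → ℝ) (t : ℝ) : ℝ := sInf (b '' Icc (0:ℝ) t)

/-- The simple-interest balance equation: `b` is continuous on `[0,T]`,
`b_t = x + ∫_0^t ((r+β) p_s − α_s) ds`, with `p` the running infimum of `b`. -/
def SimpleBal (r β T x : ℝ) (α b : ℝ → ℝ) : Prop :=
  ContinuousOn b (Icc (0:ℝ) T) ∧
  ∀ t ∈ Icc (0:ℝ) T, b t = x + ∫ s in (0:ℝ)..t, ((r + β) * runInf b s - α s)

/-- First time of principal repayment, with `inf ∅ = T`. -/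
def thetaS (T x : ℝ) (b : ℝ → ℝ) : ℝ :=
  sInf (insert T {t | t ∈ Icc (0:ℝ) T ∧ runInf b t < x})

/-- Terminal time in the simple-interest model. -/
def tauS (T : ℝ) (b : ℝ → ℝ) : ℝ :=
  sInf (insert T {t | t ∈ Icc (0:ℝ) T ∧ b t = 0})

/-- Repayment cost in the simple-interest model. -/
def costS (r T ω : ℝ) (α b : ℝ → ℝ) : ℝ :=
  (∫ t in (0:ℝ)..(tauS T b), Real.exp (-r * t) * α t)
    + ω * Real.exp (-r * tauS T b) * b (tauS T b)

theorem runInf_le {b : ℝ → ℝ} {T s t : ℝ} (hb : ContinuousOn b (Icc 0 T))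
    (hs : s ∈ Icc 0 t) (ht : t ≤ T) : runInf b t ≤ b s :=
  csInf_le (isCompact_Icc.image_of_continuousOn (hb.mono (Icc_subset_Icc_right ht))).bddBelow
    (mem_image_of_mem b hs)

theorem le_runInf {b : ℝ → ℝ} {t c : ℝ} (ht : 0 ≤ t) (h : ∀ s ∈ Icc 0 t, c ≤ b s) :
    c ≤ runInf b t := by
  refine le_csInf ((nonempty_Icc.2 ht).image b) ?_
  rintro _ ⟨s, hs, rfl⟩
  exact h s hs

theorem antitoneOn_runInf {b : ℝ → ℝ} {T : ℝ} (hb : ContinuousOn b (Icc 0 T)) :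
    AntitoneOn (runInf b) (Icc 0 T) := fun _ hs _ ht hst =>
  le_runInf hs.1 fun _ hu => runInf_le hb ⟨hu.1, hu.2.trans hst⟩ ht.2

/-- Integral form of Grönwall's inequality with zero initial value. -/
theorem eq_zero_of_le_mul_integral {d : ℝ → ℝ} {K T : ℝ} (hd : ContinuousOn d (Icc 0 T))
    (hd0 : ∀ t ∈ Icc 0 T, 0 ≤ d t)
    (h : ∀ t ∈ Icc 0 T, d t ≤ K * ∫ s in (0:ℝ)..t, d s) :
    ∀ t ∈ Icc 0 T, d t = 0 := by
  intro t ht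
  have hT : 0 ≤ T := ht.1.trans ht.2
  have hdi : ∀ u ∈ Icc 0 T, IntervalIntegrable d volume 0 u := fun u hu =>
    (hd.mono (by rw [uIcc_of_le hu.1]; exact Icc_subset_Icc_right hu.2)).intervalIntegrable
  have hF0 : ∀ u ∈ Icc 0 T, 0 ≤ ∫ s in (0:ℝ)..u, d s := fun u hu =>
    intervalIntegral.integral_nonneg hu.1 fun s hs => hd0 s ⟨hs.1, hs.2.trans hu.2⟩
  have hderiv : ∀ u ∈ Ico 0 T,
      HasDerivWithinAt (fun v => ∫ s in (0:ℝ)..v, d s) (d u) (Ici u) u := by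
    intro u hu
    have hcont : ContinuousWithinAt d (Ioi u) u :=
      ((hd u (Ico_subset_Icc_self hu)).mono (Icc_subset_Icc_left hu.1)).mono_of_mem_nhdsWithin
        (Filter.mem_of_superset (Ioc_mem_nhdsGT hu.2) Ioc_subset_Icc_self)
    refine intervalIntegral.integral_hasDerivWithinAt_right (hdi u (Ico_subset_Icc_self hu))
      ?_ hcont
    exact ⟨Ioc u T, Ioc_mem_nhdsGT hu.2, (hd.mono fun v hv =>
      ⟨hu.1.trans hv.1.le, hv.2⟩).aestronglyMeasurable measurableSet_Ioc⟩
  have hFc : ContinuousOn (fun v => ∫ s in (0:ℝ)..v, d s) (Icc 0 T) := by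
    have := intervalIntegral.continuousOn_primitive_interval (μ := volume) (f := d)
      (a := 0) (b := T) (by
        rw [uIcc_of_le hT]; exact hd.integrableOn_Icc)
    rwa [uIcc_of_le hT] at this
  have key := norm_le_gronwallBound_of_norm_deriv_right_le (K := K) (ε := 0) (δ := 0)
    hFc hderiv (by simp) (fun u hu => by
      have hu' := Ico_subset_Icc_self hu
      rw [Real.norm_of_nonneg (hd0 u hu'), Real.norm_of_nonneg (hF0 u hu'), add_zero]
      exact h u hu') t ht
  rw [gronwallBound_ε0_δ0, norm_le_zero_iff] at key
  have := h t ht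
  rw [key, mul_zero] at this
  exact le_antisymm this (hd0 t ht)

theorem Adm.integrableOn {T : ℝ} {m M α : ℝ → ℝ} (hα : α ∈ Adm T m M)
    (hm : IntegrableOn m (Icc 0 T)) (hM : IntegrableOn M (Icc 0 T)) :
    IntegrableOn α (Icc 0 T) := by
  refine integrable_of_le_of_le hα.1.aestronglyMeasurable ?_ ?_ hm hM
  · exact (ae_restrict_mem measurableSet_Icc).mono fun t ht => (hα.2 t ht).1
  · exact (ae_restrict_mem measurableSet_Icc).mono fun t ht => (hα.2 t ht).2

/-- If the balance computed with constant principal never drops below the initial principal,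
then it is the simple-interest balance. -/
theorem SimpleBal.eq_of_le {r β T x : ℝ} {α b : ℝ → ℝ} (hK : 0 ≤ r + β)
    (hb : SimpleBal r β T x α b) (hα : IntegrableOn α (Icc 0 T))
    (h : ∀ t ∈ Icc 0 T, ∫ s in (0:ℝ)..t, α s ≤ (r + β) * x * t) :
    ∀ t ∈ Icc 0 T, b t = x + (r + β) * x * t - ∫ s in (0:ℝ)..t, α s := by
  obtain ⟨hbc, hbe⟩ := hb
  intro t ht
  have hT : 0 ≤ T := ht.1.trans ht.2
  have hb0 : b 0 = x := by simpa using hbe 0 ⟨le_rfl, hT⟩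
  have hsub : ∀ {u}, u ∈ Icc 0 T → uIcc 0 u ⊆ Icc 0 T := fun {u} hu => by
    rw [uIcc_of_le hu.1]; exact Icc_subset_Icc_right hu.2
  have hαi : ∀ u ∈ Icc 0 T, IntervalIntegrable α volume 0 u := fun u hu =>
    (hα.mono_set (hsub hu)).intervalIntegrable
  have hpi : ∀ u ∈ Icc 0 T, IntervalIntegrable (runInf b) volume 0 u := fun u hu =>
    ((antitoneOn_runInf hbc).mono (hsub hu)).intervalIntegrable
  set q : ℝ → ℝ := fun s => (r + β) * (x - runInf b s) with hq
  have hqi : ∀ u ∈ Icc 0 T, IntervalIntegrable q volume 0 u := fun u hu =>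
    (intervalIntegrable_const.sub (hpi u hu)).const_mul _
  have hq0 : ∀ u ∈ Icc 0 T, 0 ≤ q u := fun u hu =>
    mul_nonneg hK (sub_nonneg.2 (hb0 ▸ runInf_le hbc ⟨le_rfl, hu.1⟩ hu.2))
  set d : ℝ → ℝ := fun u => ∫ s in (0:ℝ)..u, q s with hd
  have hbd : ∀ u ∈ Icc 0 T, b u = x + (r + β) * x * u - (∫ s in (0:ℝ)..u, α s) - d u := by
    intro u hu
    have h1 : d u = (r + β) * (u * x - ∫ s in (0:ℝ)..u, runInf b s) := by
      simp only [hd, hq]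
      rw [intervalIntegral.integral_const_mul,
        intervalIntegral.integral_sub intervalIntegrable_const (hpi u hu)]
      simp
    rw [hbe u hu, intervalIntegral.integral_sub ((hpi u hu).const_mul _) (hαi u hu),
      intervalIntegral.integral_const_mul, h1]
    ring
  have hdmono : ∀ s ∈ Icc 0 T, ∀ u ∈ Icc 0 T, s ≤ u → d s ≤ d u := fun s hs u hu hsu =>
    intervalIntegral.integral_mono_interval le_rfl hs.1 hsu
      ((ae_restrict_mem measurableSet_Ioc).mono fun v hv => hq0 v ⟨hv.1.le, hv.2.trans hu.2⟩)
      (hqi u hu)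
  have hd0 : ∀ u ∈ Icc 0 T, 0 ≤ d u := fun u hu => by
    simpa [hd] using hdmono 0 ⟨le_rfl, hT⟩ u hu hu.1
  have hdc : ContinuousOn d (Icc 0 T) := by
    have := intervalIntegral.continuousOn_primitive_interval' (hqi T ⟨hT, le_rfl⟩)
      (left_mem_uIcc)
    rwa [uIcc_of_le hT] at this
  have hqd : ∀ u ∈ Icc 0 T, q u ≤ (r + β) * d u := by
    intro u hu
    refine mul_le_mul_of_nonneg_left ?_ hK
    have : x - d u ≤ runInf b u := le_runInf hu.1 fun s hs => by
      have hs' : s ∈ Icc 0 T := ⟨hs.1, hs.2.trans hu.2⟩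
      have h1 := hdmono s hs' u hu hs.2
      have h2 := h s hs'
      rw [hbd s hs']
      linarith
    linarith
  have hzero := eq_zero_of_le_mul_integral (K := r + β) hdc hd0 (fun u hu => by
    rw [← intervalIntegral.integral_const_mul]
    exact intervalIntegral.integral_mono_on hu.1 (hqi u hu)
      ((hdc.mono (hsub hu)).intervalIntegrable.const_mul _)
      fun s hs => hqd s ⟨hs.1, hs.2.trans hu.2⟩) t ht
  rw [hbd t ht, hzero, sub_zero]

/-- If no principal is repaid before `T`, cumulative payments never exceed the interest accrued
on the initial principal. -/
theorem SimpleBal.integral_le_of_thetaS_eq {r β T x : ℝ} {α b : ℝ → ℝ} (hT : 0 < T)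
    (hb : SimpleBal r β T x α b) (hα : IntegrableOn α (Icc 0 T)) (hθ : thetaS T x b = T) :
    ∀ t ∈ Icc 0 T, ∫ s in (0:ℝ)..t, α s ≤ (r + β) * x * t := by
  obtain ⟨hbc, hbe⟩ := hb
  have hb0 : b 0 = x := by simpa using hbe 0 ⟨le_rfl, hT.le⟩
  have hp : ∀ t ∈ Ico 0 T, x ≤ runInf b t := by
    intro t ht
    by_contra! hlt
    have hbdd : BddBelow (insert T {t | t ∈ Icc (0:ℝ) T ∧ runInf b t < x}) :=
      BddBelow.insert T ⟨0, fun s hs => hs.1.1⟩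
    have : thetaS T x b ≤ t :=
      csInf_le hbdd (mem_insert_of_mem _ ⟨Ico_subset_Icc_self ht, hlt⟩)
    rw [hθ] at this
    exact absurd ht.2 this.not_gt
  have hbx : ∀ t ∈ Icc 0 T, x ≤ b t := by
    intro t ht
    have hcl : t ∈ closure (Ico 0 T) := by rwa [closure_Ico hT.ne]
    exact ContinuousWithinAt.closure_le hcl continuousWithinAt_const
      ((hbc t ht).mono Ico_subset_Icc_self) fun s hs =>
        (hp s hs).trans (runInf_le hbc ⟨hs.1, le_rfl⟩ hs.2.le)
  intro t ht
  have hpx : ∀ s ∈ uIcc 0 t, (r + β) * runInf b s - α s = (r + β) * x - α s := by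
    intro s hs
    rw [uIcc_of_le ht.1] at hs
    have : runInf b s = x := le_antisymm
      (hb0 ▸ runInf_le hbc ⟨le_rfl, hs.1⟩ (hs.2.trans ht.2))
      (le_runInf hs.1 fun u hu => hbx u ⟨hu.1, hu.2.trans (hs.2.trans ht.2)⟩)
    rw [this]
  have h1 := hbx t ht
  have hαi : IntervalIntegrable α volume 0 t := by
    refine (hα.mono_set ?_).intervalIntegrable
    rw [uIcc_of_le ht.1]
    exact Icc_subset_Icc_right ht.2
  rw [hbe t ht, intervalIntegral.integral_congr hpx,
    intervalIntegral.integral_sub intervalIntegrable_const hαi,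
    intervalIntegral.integral_const, smul_eq_mul] at h1
  linarith

theorem tauS_eq_of_pos {T : ℝ} {b : ℝ → ℝ} (h : ∀ t ∈ Icc 0 T, 0 < b t) : tauS T b = T := by
  have : {t | t ∈ Icc (0:ℝ) T ∧ b t = 0} = ∅ :=
    eq_empty_of_forall_notMem fun t ht => (h t ht.1).ne' ht.2
  rw [tauS, this, insert_empty_eq, csInf_singleton]

/-- simple interest: if even maximal payments never touch the
principal (`θ(M) = T`), then the minimal strategy attains the infimum defining
`v(x)`. Here `B α` denotes the simple-interest balance associated to each
admissible strategy `α`. -/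
theorem stmt12 (r β T ω : ℝ) (m M : ℝ → ℝ)
    (hr : 0 < r) (hβ : 0 < β) (hT : 0 < T) (hω : ω ∈ Ioo (0:ℝ) 1)
    (hmMeas : Measurable m) (hMMeas : Measurable M)
    (hmInt : IntegrableOn m (Icc (0:ℝ) T)) (hMInt : IntegrableOn M (Icc (0:ℝ) T))
    (hmM : ∀ t ∈ Icc (0:ℝ) T, 0 < m t ∧ m t < M t)
    (x : ℝ) (hx : 0 < x)
    (B : (ℝ → ℝ) → (ℝ → ℝ))
    (hB : ∀ α ∈ Adm T m M, SimpleBal r β T x α (B α))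
    (hθM : thetaS T x (B M) = T) :
    m ∈ Adm T m M ∧
    costS r T ω m (B m)
      = sInf ((fun α => costS r T ω α (B α)) '' Adm T m M) := by
  have hK : 0 ≤ r + β := by positivity
  have hm_mem : m ∈ Adm T m M := ⟨hmMeas, fun t ht => ⟨le_rfl, (hmM t ht).2.le⟩⟩
  have hM_mem : M ∈ Adm T m M := ⟨hMMeas, fun t ht => ⟨(hmM t ht).2.le, le_rfl⟩⟩
  have hint : ∀ α ∈ Adm T m M, IntegrableOn α (Icc 0 T) := fun α hα =>
    Adm.integrableOn hα hmInt hMInt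
  have hii : ∀ α ∈ Adm T m M, ∀ t ∈ Icc 0 T, IntervalIntegrable α volume 0 t := by
    intro α hα t ht
    refine ((hint α hα).mono_set ?_).intervalIntegrable
    rw [uIcc_of_le ht.1]
    exact Icc_subset_Icc_right ht.2
  have hTm : T ∈ Icc 0 T := ⟨hT.le, le_rfl⟩
  have hle : ∀ α ∈ Adm T m M, ∀ t ∈ Icc 0 T, ∫ s in (0:ℝ)..t, α s ≤ (r + β) * x * t :=
    fun α hα t ht =>
      (intervalIntegral.integral_mono_on ht.1 (hii α hα t ht) (hii M hM_mem t ht)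
        fun s hs => (hα.2 s ⟨hs.1, hs.2.trans ht.2⟩).2).trans
      ((hB M hM_mem).integral_le_of_thetaS_eq hT hMInt hθM t ht)
  have hexp : ∀ α ∈ Adm T m M,
      IntervalIntegrable (fun t => Real.exp (-r * t) * α t) volume 0 T := fun α hα =>
    (hii α hα T hTm).continuousOn_mul (by fun_prop)
  have hcost : ∀ α ∈ Adm T m M, costS r T ω α (B α) =
      (∫ t in (0:ℝ)..T, (Real.exp (-r * t) - ω * Real.exp (-r * T)) * α t)
        + ω * Real.exp (-r * T) * (x + (r + β) * x * T) := by
    intro α hα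
    have hBα := (hB α hα).eq_of_le hK (hint α hα) (hle α hα)
    have hτ : tauS T (B α) = T := tauS_eq_of_pos fun t ht => by
      rw [hBα t ht]
      linarith [hle α hα t ht]
    simp only [sub_mul]
    rw [costS, hτ, hBα T hTm, intervalIntegral.integral_sub (hexp α hα)
      ((hii α hα T hTm).const_mul _), intervalIntegral.integral_const_mul]
    ring
  refine ⟨hm_mem, Eq.symm ?_⟩
  refine IsLeast.csInf_eq ⟨⟨m, hm_mem, rfl⟩, ?_⟩
  rintro _ ⟨α, hα, rfl⟩
  simp only
  rw [hcost m hm_mem, hcost α hα]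
  have hw : ∀ γ ∈ Adm T m M, IntervalIntegrable
      (fun t => (Real.exp (-r * t) - ω * Real.exp (-r * T)) * γ t) volume 0 T := fun γ hγ =>
    (hii γ hγ T hTm).continuousOn_mul (by fun_prop)
  refine add_le_add_left (intervalIntegral.integral_mono_on hT.le (hw m hm_mem) (hw α hα)
    fun t ht => mul_le_mul_of_nonneg_left (hα.2 t ht).1 ?_) _
  have h1 : Real.exp (-r * T) ≤ Real.exp (-r * t) :=
    Real.exp_le_exp.2 (by nlinarith [ht.2])
  have h2 : ω * Real.exp (-r * T) ≤ Real.exp (-r * T) :=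
    mul_le_of_le_one_left (Real.exp_pos _).le hω.2.le
  linarith
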